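/- Let 1 < p < infinity, let w be an A_p weight on R^n, and let H be a subset of L^p(w). Suppose: (i) H is bounded in L^p(w); (ii) lim_{A -> infinity} int_{|x|>A} |f(x)|^p w(x) dx = 0 uniformly for f in H; (iii) lim_{t -> 0} ||f(. + t) - f(.)||_{L^p(w)} = 0 uniformly for f in H. Then H is precompact (totally bounded) in L^p(w). -/

import Mathlib

open MeasureTheory ENNReal Set

noncomputable section

/-- Euclidean space `ℝⁿ`. -/
abbrev Rn (n : ℕ) := EuclideanSpace ℝ (Fin n)

/-- An axis-parallel cube in `ℝⁿ`, given by its center and (positive) side length. -/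
structure Cube (n : ℕ) where
  center : Rn n
  side : ℝ
  side_pos : 0 < side

namespace Cube

variable {n : ℕ}

/-- The set of points of a cube. -/
def toSet (Q : Cube n) : Set (Rn n) := {y | ∀ i, |y i - Q.center i| ≤ Q.side / 2}

/-- The volume `|Q| = ℓ(Q)ⁿ` of a cube. -/
def vol (Q : Cube n) : ℝ := Q.side ^ n

/-- The dilate `2^k Q`: same center, side length `2^k ℓ(Q)`. -/
def dilate (Q : Cube n) (k : ℕ) : Cube n := ⟨Q.center, 2 ^ k * Q.side, by have := Q.side_pos; positivity⟩

end Cube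

instance {n : ℕ} : Nonempty (Cube n) := ⟨⟨0, 1, one_pos⟩⟩

variable {n : ℕ}

/-- Average of a real function over a cube. -/
def cubeAvg (Q : Cube n) (f : Rn n → ℝ) : ℝ := (Q.vol)⁻¹ * ∫ y in Q.toSet, f y

/-- Mean oscillation of `b` over cube `Q`. -/
def bmoDev (Q : Cube n) (b : Rn n → ℝ) : ℝ :=
  cubeAvg Q (fun y => |b y - cubeAvg Q b|)

/-- The BMO seminorm. -/
def bmoNorm (b : Rn n → ℝ) : ℝ := ⨆ Q : Cube n, bmoDev Q b

/-- Membership in BMO(ℝⁿ). -/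
def MemBMO (b : Rn n → ℝ) : Prop :=
  LocallyIntegrable b volume ∧ BddAbove (Set.range fun Q : Cube n => bmoDev Q b)

/-- Membership in CMO(ℝⁿ): the closure of `C_c^∞` in the BMO norm. -/
def MemCMO (b : Rn n → ℝ) : Prop :=
  MemBMO b ∧ ∀ ε : ℝ, 0 < ε → ∃ g : Rn n → ℝ, ContDiff ℝ (⊤ : ℕ∞) g ∧ HasCompactSupport g ∧
    ∀ Q : Cube n, bmoDev Q (fun y => b y - g y) ≤ ε

/-- The conjugate exponent `p' = p/(p-1)`. -/
def conjExp (p : ℝ) : ℝ := p / (p - 1)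

/-- The Muckenhoupt `A_p` condition for a weight `w`. -/
def IsAp (p : ℝ) (w : Rn n → ℝ) : Prop :=
  (∀ x, 0 ≤ w x) ∧ LocallyIntegrable w volume ∧
  ∃ C : ℝ, ∀ Q : Cube n,
    cubeAvg Q w * (cubeAvg Q (fun y => w y ^ (1 - conjExp p))) ^ (p - 1) ≤ C

/-- The weight `ν_{w⃗} = w₁^{p/p₁} w₂^{p/p₂}`. -/
def nuW (p p1 p2 : ℝ) (w1 w2 : Rn n → ℝ) : Rn n → ℝ :=
  fun x => w1 x ^ (p / p1) * w2 x ^ (p / p2)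

/-- The multilinear `A_{p⃗}` condition for the pair of weights `(w₁, w₂)`. -/
def IsApVec (p p1 p2 : ℝ) (w1 w2 : Rn n → ℝ) : Prop :=
  (∀ x, 0 ≤ w1 x) ∧ (∀ x, 0 ≤ w2 x) ∧
  LocallyIntegrable w1 volume ∧ LocallyIntegrable w2 volume ∧
  ∃ C : ℝ, ∀ Q : Cube n,
    (cubeAvg Q (nuW p p1 p2 w1 w2)) ^ (1 / p) *
    (cubeAvg Q (fun y => w1 y ^ (1 - conjExp p1))) ^ (1 / conjExp p1) *
    (cubeAvg Q (fun y => w2 y ^ (1 - conjExp p2))) ^ (1 / conjExp p2) ≤ C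

/-- The condition `R_θ`: `w(E)/w(Q) ≤ C (|E|/|Q|)^θ`. -/
def MemRtheta (θ : ℝ) (w : Rn n → ℝ) : Prop :=
  ∃ C : ℝ, 0 < C ∧ ∀ Q : Cube n, ∀ E ⊆ Q.toSet, MeasurableSet E →
    ∫⁻ x in E, ENNReal.ofReal (w x) ≤
      ENNReal.ofReal C * (volume E / ENNReal.ofReal Q.vol) ^ θ *
        ∫⁻ x in Q.toSet, ENNReal.ofReal (w x)

/-- Weighted `L^p(w)` norm of a real function, valued in `ℝ≥0∞`. -/
def wLp (p : ℝ) (w : Rn n → ℝ) (f : Rn n → ℝ) : ℝ≥0∞ :=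
  (∫⁻ x, ENNReal.ofReal |f x| ^ p * ENNReal.ofReal (w x)) ^ (1 / p)

/-- Weighted `L^p(w)` norm of an `ℝ≥0∞`-valued function. -/
def wLpE (p : ℝ) (w : Rn n → ℝ) (g : Rn n → ℝ≥0∞) : ℝ≥0∞ :=
  (∫⁻ x, g x ^ p * ENNReal.ofReal (w x)) ^ (1 / p)

/-- `ℝ≥0∞`-valued average of `|f|` over a cube. -/
def avgE (Q : Cube n) (f : Rn n → ℝ) : ℝ≥0∞ :=
  (ENNReal.ofReal Q.vol)⁻¹ * ∫⁻ y in Q.toSet, ENNReal.ofReal |f y|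

/-- `ℝ≥0∞`-valued average of an `ℝ≥0∞`-valued function over a cube. -/
def avgE' (Q : Cube n) (g : Rn n → ℝ≥0∞) : ℝ≥0∞ :=
  (ENNReal.ofReal Q.vol)⁻¹ * ∫⁻ y in Q.toSet, g y

/-- The bilinear maximal function `𝓜(f₁,f₂)`. -/
def MM (f1 f2 : Rn n → ℝ) (x : Rn n) : ℝ≥0∞ :=
  ⨆ (Q : Cube n) (_ : x ∈ Q.toSet), avgE Q f1 * avgE Q f2

/-- The bilinear maximal operator `𝓜_{2,1}` of Grafakos–Liu–Yang. -/
def M21 (f1 f2 : Rn n → ℝ) (x : Rn n) : ℝ≥0∞ :=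
  ⨆ (Q : Cube n) (_ : x ∈ Q.toSet),
    ∑' k : ℕ, ENNReal.ofReal ((2:ℝ) ^ (-((k : ℝ) * n))) * avgE Q f1 * avgE (Q.dilate k) f2

/-- The bilinear maximal operator `𝓜_{2,2}`. -/
def M22 (f1 f2 : Rn n → ℝ) (x : Rn n) : ℝ≥0∞ :=
  ⨆ (Q : Cube n) (_ : x ∈ Q.toSet),
    ∑' k : ℕ, ENNReal.ofReal ((2:ℝ) ^ (-((k : ℝ) * n))) * avgE Q f2 * avgE (Q.dilate k) f1

/-- Hu's bilinear maximal operator `𝓜¹_β`, with sum over `k ≥ 1`. -/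
def M1beta (β : ℝ) (f1 f2 : Rn n → ℝ) (x : Rn n) : ℝ≥0∞ :=
  ⨆ (Q : Cube n) (_ : x ∈ Q.toSet),
    avgE Q f1 * ∑' k : ℕ,
      ENNReal.ofReal ((2:ℝ) ^ (((k : ℝ) + 1) * (β - n))) * avgE (Q.dilate (k + 1)) f2

/-- Hu's bilinear maximal operator `𝓜²_β`, with sum over `k ≥ 1`. -/
def M2beta (β : ℝ) (f1 f2 : Rn n → ℝ) (x : Rn n) : ℝ≥0∞ :=
  ⨆ (Q : Cube n) (_ : x ∈ Q.toSet),
    avgE Q f2 * ∑' k : ℕ,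
      ENNReal.ofReal ((2:ℝ) ^ (((k : ℝ) + 1) * (β - n))) * avgE (Q.dilate (k + 1)) f1

/-- The maximal operator `M_δ f = M(|f|^δ)^{1/δ}` (Hardy–Littlewood for `δ = 1`). -/
def Mdelta (δ : ℝ) (f : Rn n → ℝ) (x : Rn n) : ℝ≥0∞ :=
  (⨆ (Q : Cube n) (_ : x ∈ Q.toSet),
    avgE' Q (fun y => ENNReal.ofReal |f y| ^ δ)) ^ (1 / δ)

/-- The Fefferman–Stein sharp maximal operator `M^{♯}_δ f = M^{♯}(|f|^δ)^{1/δ}`. -/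
def sharpDelta (δ : ℝ) (f : Rn n → ℝ) (x : Rn n) : ℝ≥0∞ :=
  (⨆ (Q : Cube n) (_ : x ∈ Q.toSet),
    ⨅ c : ℝ, avgE' Q (fun y => ENNReal.ofReal |(|f y| ^ δ) - c|)) ^ (1 / δ)

/-- `Φ(t) = t (1 + log⁺ t)`. -/
def PhiLL (t : ℝ) : ℝ := t * (1 + max (Real.log t) 0)

/-- The `L(log L)` Luxemburg norm of `f` over the cube `Q`. -/
def llogNorm (Q : Cube n) (f : Rn n → ℝ) : ℝ :=
  sInf {lam : ℝ | 0 < lam ∧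
    ∫⁻ y in Q.toSet, ENNReal.ofReal (PhiLL (|f y| / lam)) ≤ ENNReal.ofReal Q.vol}

/-- The bilinear maximal operator `𝓜_{L(log L)}`. -/
def MLlogL (f1 f2 : Rn n → ℝ) (x : Rn n) : ℝ≥0∞ :=
  ⨆ (Q : Cube n) (_ : x ∈ Q.toSet), ENNReal.ofReal (llogNorm Q f1 * llogNorm Q f2)

/-- The size condition (1.2) with constant `A`. -/
def SizeCond (K : Rn n → Rn n → Rn n → ℝ) (A : ℝ) : Prop :=
  ∀ x y1 y2 : Rn n, (x ≠ y1 ∨ x ≠ y2) →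
    |K x y1 y2| ≤ A / (dist x y1 + dist x y2) ^ (2 * (n : ℝ))

/-- The non-smooth regularity condition (1.7) with constant `D` and exponent `γ`. -/
def RegCond (K : Rn n → Rn n → Rn n → ℝ) (D γ : ℝ) : Prop :=
  ∀ x x' y1 y2 : Rn n, ∀ τ : ℝ,
    8 * dist x x' < min (dist x y1) (dist x y2) →
    2 * dist x x' < τ → 4 * τ < min (dist x y1) (dist x y2) →
    |K x y1 y2 - K x' y1 y2| ≤ D * τ ^ γ / (dist x y1 + dist x y2) ^ (2 * (n : ℝ) + γ)

/-- Bounded, measurable, compactly supported function. -/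
def BCS (f : Rn n → ℝ) : Prop :=
  Measurable f ∧ HasCompactSupport f ∧ ∃ M : ℝ, ∀ x, |f x| ≤ M

/-- `T` is the bilinear singular integral operator associated with the kernel `K`
in the sense of (1.1). -/
def AssocKernel (T : (Rn n → ℝ) → (Rn n → ℝ) → Rn n → ℝ)
    (K : Rn n → Rn n → Rn n → ℝ) : Prop :=
  ∀ f1 f2 : Rn n → ℝ, BCS f1 → BCS f2 → ∀ x : Rn n,
    x ∉ tsupport f1 ∩ tsupport f2 →
    T f1 f2 x = ∫ z : Rn n × Rn n, K x z.1 z.2 * f1 z.1 * f2 z.2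

/-- Condition (1.6): `T` maps `L¹ × L¹` boundedly into `L^{1/2,∞}`. -/
def WeakTypeBound (T : (Rn n → ℝ) → (Rn n → ℝ) → Rn n → ℝ) : Prop :=
  ∃ B : ℝ, 0 < B ∧ ∀ f1 f2 : Rn n → ℝ, Integrable f1 volume → Integrable f2 volume →
    ∀ lam : ℝ, 0 < lam →
      volume {x | lam < |T f1 f2 x|} ≤
        ENNReal.ofReal ((B * (∫ y, |f1 y|) * (∫ y, |f2 y|) / lam) ^ ((1:ℝ) / 2))

/-- The commutator `[b,T]₁(f₁,f₂) = T(b f₁, f₂) - b T(f₁,f₂)`. -/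
def comm1 (b : Rn n → ℝ) (T : (Rn n → ℝ) → (Rn n → ℝ) → Rn n → ℝ)
    (f1 f2 : Rn n → ℝ) : Rn n → ℝ :=
  fun x => T (fun y => b y * f1 y) f2 x - b x * T f1 f2 x

/-- The commutator `[b,T]₂(f₁,f₂) = T(f₁, b f₂) - b T(f₁,f₂)`. -/
def comm2 (b : Rn n → ℝ) (T : (Rn n → ℝ) → (Rn n → ℝ) → Rn n → ℝ)
    (f1 f2 : Rn n → ℝ) : Rn n → ℝ :=
  fun x => T f1 (fun y => b y * f2 y) x - b x * T f1 f2 x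

/-- The iterated commutator `T_{b⃗} = [b₂,[b₁,T]₁]₂`. -/
def itComm (b1 b2 : Rn n → ℝ) (T : (Rn n → ℝ) → (Rn n → ℝ) → Rn n → ℝ)
    (f1 f2 : Rn n → ℝ) : Rn n → ℝ :=
  comm2 b2 (comm1 b1 T) f1 f2

/-- The triple product space `ℝ^{3n}`. -/
abbrev E3 (n : ℕ) := Rn n × Rn n × Rn n

/-- A nonnegative `C_c^∞` bump function on `ℝ^{3n}` supported in
`{max(|x|,|y₁|,|y₂|) < 1}` with integral `1`. -/
def GoodPhi (φ : E3 n → ℝ) : Prop :=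
  ContDiff ℝ (⊤ : ℕ∞) φ ∧ HasCompactSupport φ ∧ (∀ u, 0 ≤ φ u) ∧
  tsupport φ ⊆ {u : E3 n | max ‖u.1‖ (max ‖u.2.1‖ ‖u.2.2‖) < 1} ∧
  ∫ u : E3 n, φ u = 1

/-- The smooth truncation `ψ^δ = φ_δ * χ^δ`. -/
def psiDelta (φ : E3 n → ℝ) (δ : ℝ) (u : E3 n) : ℝ :=
  ∫ v : E3 n, ((δ / 4) ^ (3 * n))⁻¹ * φ ((4 / δ) • (u - v)) *
    Set.indicator {w : E3 n | 3 * δ / 2 ≤ max (dist w.1 w.2.1) (dist w.1 w.2.2)}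
      (fun _ => (1:ℝ)) v

/-- The truncated kernel `K^δ = ψ^δ K`. -/
def Kdelta (φ : E3 n → ℝ) (δ : ℝ) (K : Rn n → Rn n → Rn n → ℝ) :
    Rn n → Rn n → Rn n → ℝ :=
  fun x y1 y2 => psiDelta φ δ (x, y1, y2) * K x y1 y2

/-- The truncated bilinear operator `T^δ` associated with `K^δ`. -/
def Tdelta (φ : E3 n → ℝ) (δ : ℝ) (K : Rn n → Rn n → Rn n → ℝ)
    (f1 f2 : Rn n → ℝ) : Rn n → ℝ :=
  fun x => ∫ z : Rn n × Rn n, Kdelta φ δ K x z.1 z.2 * f1 z.1 * f2 z.2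

/-- The maximal truncated bilinear singular integral operator `T^*`. -/
def Tstar (K : Rn n → Rn n → Rn n → ℝ) (f1 f2 : Rn n → ℝ) (x : Rn n) : ℝ≥0∞ :=
  ⨆ (η : ℝ) (_ : 0 < η), ENNReal.ofReal
    |∫ z : Rn n × Rn n,
      Set.indicator {z : Rn n × Rn n | η < max (dist x z.1) (dist x z.2)}
        (fun z => K x z.1 z.2 * f1 z.1 * f2 z.2) z|

end

namespace FK

variable {n : ℕ}

/-- Jensen for the power function, in a form needing no integrability. -/
theorem jensen {E : Type*} [MeasurableSpace E] (ρ : Measure E) [IsProbabilityMeasure ρ]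
    (p : ℝ) (hp : 1 ≤ p) (f : E → ℝ) (hf : Measurable f) (a : ℝ) :
    ‖a - ∫ y, f y ∂ρ‖ₑ ^ p ≤ ∫⁻ y, ‖a - f y‖ₑ ^ p ∂ρ := by
  have hp0 : 0 < p := by linarith
  by_cases htop : ∫⁻ y, ‖a - f y‖ₑ ^ p ∂ρ = ∞
  · rw [htop]; exact le_top
  have hP0 : ENNReal.ofReal p ≠ 0 := by simpa using hp0
  have hPr : (ENNReal.ofReal p).toReal = p := ENNReal.toReal_ofReal hp0.le
  have hg : Measurable (fun y => a - f y) := hf.const_sub a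
  have he : eLpNorm (fun y => a - f y) (ENNReal.ofReal p) ρ
      = (∫⁻ y, ‖a - f y‖ₑ ^ p ∂ρ) ^ (1 / p) := by
    rw [eLpNorm_eq_lintegral_rpow_enorm_toReal hP0 ENNReal.ofReal_ne_top, hPr]
  have hmono : eLpNorm (fun y => a - f y) 1 ρ ≤ eLpNorm (fun y => a - f y) (ENNReal.ofReal p) ρ :=
    eLpNorm_le_eLpNorm_of_exponent_le (by simpa using hp) hg.aestronglyMeasurable
  have hlt : eLpNorm (fun y => a - f y) (ENNReal.ofReal p) ρ < ∞ := by
    rw [he]; exact ENNReal.rpow_lt_top_of_nonneg (by positivity) htop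
  have hint : Integrable (fun y => a - f y) ρ :=
    memLp_one_iff_integrable.1 ⟨hg.aestronglyMeasurable, hmono.trans_lt hlt⟩
  have hfi : Integrable f ρ := by
    have := (integrable_const (μ := ρ) a).sub hint
    refine this.congr (Filter.Eventually.of_forall fun y => ?_)
    simp
  have h1 : a - ∫ y, f y ∂ρ = ∫ y, (a - f y) ∂ρ := by
    rw [integral_sub (integrable_const a) hfi]; simp
  rw [h1]
  have h2 : ‖∫ y, (a - f y) ∂ρ‖ₑ ≤ (∫⁻ y, ‖a - f y‖ₑ ^ p ∂ρ) ^ (1 / p) := by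
    rw [← he]
    refine le_trans (enorm_integral_le_lintegral_enorm _) ?_
    rw [← eLpNorm_one_eq_lintegral_enorm]; exact hmono
  calc _ ≤ ((∫⁻ y, ‖a - f y‖ₑ ^ p ∂ρ) ^ (1 / p)) ^ p := ENNReal.rpow_le_rpow h2 hp0.le
    _ = _ := by rw [← ENNReal.rpow_mul]; simp [hp0.ne']

/-- index of the grid cell containing `x`. -/
noncomputable def idx (h : ℝ) (x : Rn n) : Fin n → ℤ := fun i => ⌊x i / h⌋

/-- grid cell. -/
def cell (h : ℝ) (k : Fin n → ℤ) : Set (Rn n) := idx h ⁻¹' {k}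

theorem measurable_idx (h : ℝ) : Measurable (idx (n := n) h) := by
  refine measurable_pi_lambda _ fun i => ?_
  refine Int.measurable_floor.comp ?_
  fun_prop

theorem measurableSet_cell (h : ℝ) (k : Fin n → ℤ) : MeasurableSet (cell h k) :=
  measurable_idx h (measurableSet_singleton k)

theorem cell_lower (h : ℝ) (hh : 0 < h) (k : Fin n → ℤ) :
    volume (Metric.ball (0 : Rn n) (h / 2)) ≤ volume (cell h k) := by
  have hsub : Metric.ball (WithLp.toLp 2 (fun i => h * (k i + 1 / 2)) : Rn n) (h / 2) ⊆ cell h k := by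
    intro x hx
    simp only [cell, mem_preimage, mem_singleton_iff]
    funext i
    rw [mem_ball_iff_norm] at hx
    have h1 := (PiLp.norm_apply_le (x - (WithLp.toLp 2 (fun i => h * (k i + 1 / 2)) : Rn n)) i).trans_lt hx
    simp only [PiLp.sub_apply, Real.norm_eq_abs, abs_lt] at h1
    simp only [idx]
    rw [Int.floor_eq_iff, le_div_iff₀ hh, div_lt_iff₀ hh]
    constructor <;> nlinarith
  refine le_trans (le_of_eq ?_) (measure_mono hsub)
  exact (Measure.addHaar_ball_center _ _ _).symm

theorem cell_sub (h : ℝ) (hh : 0 < h) (x : Rn n) :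
    cell h (idx h x) ⊆ Metric.ball x (2 * (n + 1) * (h / 2)) := by
  intro y hy
  simp only [cell, mem_preimage, mem_singleton_iff] at hy
  rw [mem_ball_iff_norm]
  have hb : ∀ i, ‖(y - x) i‖ ≤ h := by
    intro i
    have h1 := congrFun hy i
    simp only [idx] at h1
    have h2 := Int.abs_sub_lt_one_of_floor_eq_floor h1
    rw [← sub_div, abs_div, abs_of_pos hh, div_lt_one hh] at h2
    simpa using h2.le
  have : ‖y - x‖ ≤ n * h := by
    rw [EuclideanSpace.norm_eq]
    refine Real.sqrt_le_iff.2 ⟨by positivity, ?_⟩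
    calc ∑ i, ‖(y - x) i‖ ^ 2 ≤ ∑ i : Fin n, h ^ 2 :=
          Finset.sum_le_sum fun i _ => by gcongr; exact hb i
      _ = n * h ^ 2 := by simp
      _ ≤ (n * h) ^ 2 := by
          have : (n : ℝ) ≤ n ^ 2 := by exact_mod_cast Nat.le_self_pow (by norm_num) n
          rw [mul_pow]; gcongr
  nlinarith

/-- the dominating local oscillation. -/
noncomputable def J (p h : ℝ) (f : Rn n → ℝ) (x : Rn n) : ℝ≥0∞ :=
  (volume (Metric.ball (0 : Rn n) (h / 2)))⁻¹ *
    ∫⁻ t in Metric.ball (0 : Rn n) (2 * (n + 1) * (h / 2)), ‖f (x + t) - f x‖ₑ ^ p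

/-- mean over a cell -/
noncomputable def mean (h : ℝ) (f : Rn n → ℝ) (k : Fin n → ℤ) : ℝ :=
  ∫ y, f y ∂((volume (cell h k))⁻¹ • (volume.restrict (cell h k)))

theorem measurable_diff {p : ℝ} {f : Rn n → ℝ} (hf : Measurable f) :
    Measurable (fun z : Rn n × Rn n => ‖f (z.1 + z.2) - f z.1‖ₑ ^ p) := by
  have : Measurable (fun z : Rn n × Rn n => f (z.1 + z.2) - f z.1) :=
    (hf.comp (measurable_fst.add measurable_snd)).sub (hf.comp measurable_fst)
  exact this.enorm.pow_const p

theorem measurable_J {p h : ℝ} {f : Rn n → ℝ} (hf : Measurable f) : Measurable (J p h f) := by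
  unfold J
  refine Measurable.const_mul ?_ _
  exact (measurable_diff hf).lintegral_prod_right'

theorem vball_pos {h : ℝ} (hh : 0 < h) : volume (Metric.ball (0 : Rn n) (h / 2)) ≠ 0 :=
  (Metric.measure_ball_pos volume _ (by positivity)).ne'

theorem pointwise {p h : ℝ} (hp : 1 ≤ p) (hh : 0 < h) {f : Rn n → ℝ} (hf : Measurable f)
    (x : Rn n) : ‖f x - mean h f (idx h x)‖ₑ ^ p ≤ J p h f x := by
  set k := idx h x with hk
  have h0 : volume (cell h k) ≠ 0 := fun h0 => vball_pos (n := n) hh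
    (le_antisymm (h0 ▸ cell_lower h hh k) zero_le)
  have hT : volume (cell h k) ≠ ∞ :=
    ((measure_mono (cell_sub h hh x)).trans_lt measure_ball_lt_top).ne
  have : IsProbabilityMeasure ((volume (cell h k))⁻¹ • (volume.restrict (cell h k))) := by
    constructor
    simp [ENNReal.inv_mul_cancel h0 hT]
  refine (jensen _ p hp f hf (f x)).trans ?_
  rw [lintegral_smul_measure, smul_eq_mul, J]
  refine mul_le_mul' (ENNReal.inv_le_inv.2 (cell_lower h hh k)) ?_
  refine (lintegral_mono_set (cell_sub h hh x)).trans ?_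
  rw [← lintegral_indicator Metric.isOpen_ball.measurableSet,
    ← lintegral_indicator Metric.isOpen_ball.measurableSet,
    ← lintegral_add_left_eq_self _ x]
  refine le_of_eq (lintegral_congr fun t => ?_)
  simp only [indicator, mem_ball_iff_norm, add_sub_cancel_left, sub_zero]
  congr 2
  rw [← enorm_neg, neg_sub]

theorem lintegral_J_le {p h : ℝ} (hh : 0 < h) {f : Rn n → ℝ} (hf : Measurable f)
    (μ : Measure (Rn n)) [SFinite μ] (e : ℝ≥0∞)
    (ht : ∀ t : Rn n, ‖t‖ < 2 * (n + 1) * (h / 2) → ∫⁻ x, ‖f (x + t) - f x‖ₑ ^ p ∂μ ≤ e) :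
    ∫⁻ x, J p h f x ∂μ ≤ ENNReal.ofReal ((2 * (n + 1)) ^ n) * e := by
  unfold J
  rw [lintegral_const_mul _ (measurable_diff hf).lintegral_prod_right']
  rw [lintegral_lintegral_swap (measurable_diff hf).aemeasurable]
  have h1 : ∫⁻ t in Metric.ball (0 : Rn n) (2 * (n + 1) * (h / 2)),
      ∫⁻ x, ‖f (x + t) - f x‖ₑ ^ p ∂μ ≤
      ∫⁻ t in Metric.ball (0 : Rn n) (2 * (n + 1) * (h / 2)), e := by
    refine setLIntegral_mono' Metric.isOpen_ball.measurableSet fun t ht' => ht t ?_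
    simpa using ht'
  refine (mul_le_mul' le_rfl h1).trans ?_
  rw [setLIntegral_const, Measure.addHaar_ball_mul_of_pos _ _ (by positivity)]
  have hv := vball_pos (n := n) hh
  have hv' : volume (Metric.ball (0 : Rn n) (h / 2)) ≠ ∞ := measure_ball_lt_top.ne
  simp only [finrank_euclideanSpace, Fintype.card_fin]
  set v := volume (Metric.ball (0 : Rn n) (h / 2))
  calc v⁻¹ * (e * (ENNReal.ofReal ((2 * (n + 1)) ^ n) * v))
      = (v⁻¹ * v) * (ENNReal.ofReal ((2 * (n + 1)) ^ n) * e) := by ring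
    _ ≤ _ := by rw [ENNReal.inv_mul_cancel hv hv', one_mul]

theorem add_pow_le {p : ℝ} (hp : 1 ≤ p) (a b c : ℝ) (h : c = a + b) :
    ‖c‖ₑ ^ p ≤ 2 ^ (p - 1) * (‖a‖ₑ ^ p + ‖b‖ₑ ^ p) := by
  subst h
  exact (ENNReal.rpow_le_rpow (enorm_add_le a b) (by linarith)).trans
    (ENNReal.rpow_add_le_mul_rpow_add_rpow _ _ hp)

theorem sub_pow_le {p : ℝ} (hp : 1 ≤ p) (a b c : ℝ) (h : c = a - b) :
    ‖c‖ₑ ^ p ≤ 2 ^ (p - 1) * (‖a‖ₑ ^ p + ‖b‖ₑ ^ p) := by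
  have := add_pow_le hp a (-b) c (by linarith)
  simpa using this

theorem mean_bound {p h : ℝ} (hp : 1 ≤ p) (hh : 0 < h) {f : Rn n → ℝ} (hf : Measurable f)
    (μ : Measure (Rn n)) (k : Fin n → ℤ) (C D : ℝ≥0∞)
    (hC : ∫⁻ x, ‖f x‖ₑ ^ p ∂μ ≤ C) (hD : ∫⁻ x, J p h f x ∂μ ≤ D) :
    ‖mean h f k‖ₑ ^ p * μ (cell h k) ≤ 2 ^ (p - 1) * (C + D) := by
  rw [← setLIntegral_const]
  calc ∫⁻ _ in cell h k, ‖mean h f k‖ₑ ^ p ∂μ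
      ≤ ∫⁻ x in cell h k, 2 ^ (p - 1) * (‖f x‖ₑ ^ p + J p h f x) ∂μ := by
        refine setLIntegral_mono' (measurableSet_cell h k) fun x hx => ?_
        simp only [cell, mem_preimage, mem_singleton_iff] at hx
        refine (sub_pow_le hp (f x) (f x - mean h f k) _ (by ring)).trans ?_
        gcongr
        rw [← hx]
        exact pointwise hp hh hf x
    _ ≤ ∫⁻ x, 2 ^ (p - 1) * (‖f x‖ₑ ^ p + J p h f x) ∂μ := setLIntegral_le_lintegral _ _
    _ = 2 ^ (p - 1) * (∫⁻ x, ‖f x‖ₑ ^ p ∂μ + ∫⁻ x, J p h f x ∂μ) := by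
        rw [lintegral_const_mul' _ _ (ENNReal.rpow_ne_top_of_nonneg (by linarith) (by norm_num)),
          lintegral_add_left (hf.enorm.pow_const p)]
    _ ≤ _ := by gcongr

theorem main {p : ℝ} (hp : 1 ≤ p) (μ : Measure (Rn n)) [SFinite μ]
    (hfin : ∀ r : ℝ, μ (Metric.closedBall 0 r) < ∞)
    (H : Set (Rn n → ℝ)) (hmeas : ∀ f ∈ H, Measurable f)
    (hb : ∃ C : ℝ≥0∞, C ≠ ∞ ∧ ∀ f ∈ H, ∫⁻ x, ‖f x‖ₑ ^ p ∂μ ≤ C)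
    (hd : ∀ e : ℝ≥0∞, e ≠ 0 → e ≠ ∞ → ∃ A : ℝ, ∀ f ∈ H,
      ∫⁻ x in {x : Rn n | A < ‖x‖}, ‖f x‖ₑ ^ p ∂μ ≤ e)
    (ht : ∀ e : ℝ≥0∞, e ≠ 0 → e ≠ ∞ → ∃ t0 : ℝ, 0 < t0 ∧ ∀ t : Rn n, ‖t‖ < t0 →
      ∀ f ∈ H, ∫⁻ x, ‖f (x + t) - f x‖ₑ ^ p ∂μ ≤ e)
    (e : ℝ≥0∞) (he : e ≠ 0) (heT : e ≠ ∞) :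
    ∃ G : Set (Rn n → ℝ), G.Finite ∧ G ⊆ H ∧ ∀ f ∈ H, ∃ g ∈ G, ∫⁻ x, ‖f x - g x‖ₑ ^ p ∂μ ≤ e := by
  have hp0 : 0 < p := by linarith
  obtain ⟨C, hCT, hC⟩ := hb
  set c : ℝ≥0∞ := 2 ^ (p - 1) with hc
  have hcT : c ≠ ∞ := ENNReal.rpow_ne_top_of_nonneg (by linarith) (by norm_num)
  set R : ℝ≥0∞ := ENNReal.ofReal ((2 * (n + 1)) ^ n) with hR
  have hRT : R ≠ ∞ := ENNReal.ofReal_ne_top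
  have he4 : e / 4 ≠ 0 := ENNReal.div_ne_zero.2 ⟨he, by norm_num⟩
  have he4T : e / 4 ≠ ∞ := ENNReal.div_ne_top heT (by norm_num)
  -- generic choice of small constants
  have choice : ∀ K : ℝ≥0∞, K ≠ ∞ → ∃ z : ℝ≥0∞, z ≠ 0 ∧ z ≠ ∞ ∧ K * z ≤ e / 4 := by
    intro K hK
    refine ⟨e / 4 / (K + 1), ENNReal.div_ne_zero.2 ⟨he4, by simp [hK]⟩,
      ENNReal.div_ne_top he4T (by simp), ?_⟩
    calc K * (e / 4 / (K + 1)) ≤ (K + 1) * (e / 4 / (K + 1)) := by gcongr; exact le_self_add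
      _ ≤ e / 4 := ENNReal.mul_div_le
  obtain ⟨e1, he1, he1T, he1K⟩ := choice (c * 2) (ENNReal.mul_ne_top hcT (by norm_num))
  obtain ⟨e2, he2, he2T, he2K⟩ := choice (c * c * 2 * R)
    (ENNReal.mul_ne_top (ENNReal.mul_ne_top (ENNReal.mul_ne_top hcT hcT) (by norm_num)) hRT)
  obtain ⟨A, hA⟩ := hd e1 he1 he1T
  obtain ⟨t0, ht0, htr⟩ := ht e2 he2 he2T
  obtain ⟨h, hh, hht⟩ : ∃ h : ℝ, 0 < h ∧ 2 * (n + 1) * (h / 2) ≤ t0 :=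
    ⟨t0 / (n + 1), by positivity, le_of_eq (by field_simp)⟩
  have hJ : ∀ f ∈ H, ∫⁻ x, J p h f x ∂μ ≤ R * e2 := fun f hf =>
    lintegral_J_le hh (hmeas f hf) μ e2 fun t h1 => htr t (h1.trans_le hht) f hf
  set V := μ (Metric.closedBall (0 : Rn n) A) with hV
  obtain ⟨z, hz, hzT, hzK⟩ := choice (c * V) (ENNReal.mul_ne_top hcT (hfin A).ne)
  obtain ⟨η, hη, hηz⟩ : ∃ η : ℝ, 0 < η ∧ ENNReal.ofReal η ^ p = z := by
    have hzT' : z ^ (1 / p) ≠ ∞ := ENNReal.rpow_ne_top_of_nonneg (by positivity) hzT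
    refine ⟨(z ^ (1 / p)).toReal, ENNReal.toReal_pos ?_ hzT', ?_⟩
    · simp [ENNReal.rpow_eq_zero_iff, hz, hzT]
    · rw [ENNReal.ofReal_toReal hzT', ← ENNReal.rpow_mul]; simp [hp0.ne']
  -- index set
  obtain ⟨N, hN⟩ : ∃ N : ℤ, ∀ x ∈ Metric.closedBall (0 : Rn n) A, ∀ i, -N ≤ idx h x i ∧ idx h x i ≤ N := by
    refine ⟨⌈A / h⌉ + 1, fun x hx i => ?_⟩
    have h1 : |x i| ≤ A := by
      have := PiLp.norm_apply_le x i
      rw [mem_closedBall_zero_iff] at hx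
      simpa using this.trans hx
    rw [abs_le] at h1
    have h2 : -(A / h) ≤ x i / h := by rw [← neg_div]; gcongr; exact h1.1
    have h3 : x i / h ≤ A / h := by gcongr; exact h1.2
    have h4 := Int.le_ceil (A / h)
    simp only [idx]
    constructor
    · rw [Int.le_floor]; push_cast; linarith
    · have h5 := Int.floor_le (x i / h)
      have : (⌊x i / h⌋ : ℝ) ≤ ⌈A / h⌉ := by linarith
      have : ⌊x i / h⌋ ≤ ⌈A / h⌉ := by exact_mod_cast this
      linarith
  let S : Set (Fin n → ℤ) := {k | k ∈ Icc (fun _ => -N) (fun _ => N) ∧ μ (cell h k) ≠ 0 ∧ μ (cell h k) ≠ ∞}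
  have hSfin : S.Finite := (Set.finite_Icc (fun _ : Fin n => -N) (fun _ => N)).subset fun k hk => hk.1
  have : Fintype S := hSfin.fintype
  let Φ : (Rn n → ℝ) → (S → ℝ) := fun f k => mean h f k.1
  have hbd : Bornology.IsBounded (Φ '' H) := by
    rw [← Bornology.forall_isBounded_image_eval_iff]
    intro k
    set B : ℝ≥0∞ := (c * (C + R * e2) / μ (cell h k.1)) ^ (1 / p) with hB
    have hBT : B ≠ ∞ := by
      refine ENNReal.rpow_ne_top_of_nonneg (by positivity) (ENNReal.div_ne_top ?_ k.2.2.1)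
      exact ENNReal.mul_ne_top hcT (ENNReal.add_ne_top.2 ⟨hCT, ENNReal.mul_ne_top hRT he2T⟩)
    refine (Metric.isBounded_closedBall (x := (0 : ℝ)) (r := B.toReal)).subset ?_
    rintro _ ⟨_, ⟨f, hf, rfl⟩, rfl⟩
    have h1 := mean_bound hp hh (hmeas f hf) μ k.1 C (R * e2) (hC f hf) (hJ f hf)
    have h2 : ‖mean h f k.1‖ₑ ≤ B := by
      rw [hB, one_div, ENNReal.le_rpow_inv_iff hp0]
      exact (ENNReal.le_div_iff_mul_le (Or.inl k.2.2.1) (Or.inl k.2.2.2)).2 h1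
    have h3 := ENNReal.toReal_mono hBT h2
    rw [toReal_enorm] at h3
    simpa [Φ] using h3
  have htb : TotallyBounded (Φ '' H) :=
    hbd.isCompact_closure.totallyBounded.subset subset_closure
  obtain ⟨T, hTsub, hTfin, hTcov⟩ := Metric.finite_approx_of_totallyBounded htb η hη
  obtain ⟨G, hGH, hGfin, hGT⟩ : ∃ G ⊆ H, G.Finite ∧ Φ '' G = T := by
    obtain ⟨G, hG, hGfin, hGe⟩ := Set.exists_subset_image_finite_and (p := fun s => s = T) |>.1
      ⟨T, hTsub, hTfin, rfl⟩
    exact ⟨G, hG, hGfin, hGe⟩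
  refine ⟨G, hGfin, hGH, fun f hf => ?_⟩
  have h1 := hTcov (mem_image_of_mem Φ hf)
  rw [← hGT] at h1
  simp only [mem_iUnion, exists_prop] at h1
  obtain ⟨_, ⟨g, hg, rfl⟩, hdist⟩ := h1
  refine ⟨g, hg, ?_⟩
  have hgH := hGH hg
  have hfm := hmeas f hf
  have hgm := hmeas g hgH
  have hUm : MeasurableSet {x : Rn n | A < ‖x‖} := measurableSet_lt measurable_const measurable_norm
  have hcompl : {x : Rn n | A < ‖x‖}ᶜ = Metric.closedBall 0 A := by
    ext x; simp
  rw [← lintegral_add_compl _ hUm, hcompl]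
  have hout : ∫⁻ x in {x : Rn n | A < ‖x‖}, ‖f x - g x‖ₑ ^ p ∂μ ≤ e / 4 := by
    calc ∫⁻ x in {x : Rn n | A < ‖x‖}, ‖f x - g x‖ₑ ^ p ∂μ
        ≤ ∫⁻ x in {x : Rn n | A < ‖x‖}, c * (‖f x‖ₑ ^ p + ‖g x‖ₑ ^ p) ∂μ :=
          lintegral_mono fun x => sub_pow_le hp _ _ _ rfl
      _ = c * (∫⁻ x in {x : Rn n | A < ‖x‖}, ‖f x‖ₑ ^ p ∂μ
            + ∫⁻ x in {x : Rn n | A < ‖x‖}, ‖g x‖ₑ ^ p ∂μ) := by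
          rw [lintegral_const_mul' _ _ hcT,
            lintegral_add_left (hfm.enorm.pow_const p)]
      _ ≤ c * (e1 + e1) := by gcongr <;> [exact hA f hf; exact hA g hgH]
      _ = c * 2 * e1 := by ring
      _ ≤ e / 4 := he1K
  have hnull : ∀ᵐ x ∂μ, ∀ k : Fin n → ℤ, μ (cell h k) = 0 → x ∉ cell h k := by
    rw [ae_all_iff]
    intro k
    by_cases hk : μ (cell h k) = 0
    · filter_upwards [measure_eq_zero_iff_ae_notMem.1 hk] with x hx _ using hx
    · exact Filter.Eventually.of_forall fun x h' => absurd h' hk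
  have hin : ∫⁻ x in Metric.closedBall (0 : Rn n) A, ‖f x - g x‖ₑ ^ p ∂μ ≤ e / 4 + e / 4 := by
    calc ∫⁻ x in Metric.closedBall (0 : Rn n) A, ‖f x - g x‖ₑ ^ p ∂μ
        ≤ ∫⁻ x in Metric.closedBall (0 : Rn n) A, c * (c * (J p h f x + J p h g x) + z) ∂μ := by
          refine setLIntegral_mono_ae' Metric.isClosed_closedBall.measurableSet ?_
          filter_upwards [hnull] with x hx hxA
          have hk0 : μ (cell h (idx h x)) ≠ 0 := fun h0 => hx _ h0 rfl
          have hkT : μ (cell h (idx h x)) ≠ ∞ := by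
            refine ((measure_mono ((cell_sub h hh x).trans ?_)).trans_lt
              (hfin (2 * (n + 1) * (h / 2) + ‖x‖))).ne
            refine Metric.ball_subset_closedBall.trans (Metric.closedBall_subset_closedBall' ?_)
            simp
          have hkS : idx h x ∈ S := ⟨⟨fun i => (hN x hxA i).1, fun i => (hN x hxA i).2⟩, hk0, hkT⟩
          have hm : ‖mean h f (idx h x) - mean h g (idx h x)‖ₑ ^ p ≤ z := by
            rw [← hηz]
            refine ENNReal.rpow_le_rpow ?_ hp0.le
            have := (dist_le_pi_dist (Φ f) (Φ g) ⟨idx h x, hkS⟩).trans (le_of_lt hdist)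
            rw [Real.dist_eq] at this
            rw [Real.enorm_eq_ofReal_abs]
            exact ENNReal.ofReal_le_ofReal this
          refine (add_pow_le hp ((f x - mean h f (idx h x)) - (g x - mean h g (idx h x)))
            (mean h f (idx h x) - mean h g (idx h x)) _ (by ring)).trans ?_
          gcongr
          refine (sub_pow_le hp _ _ _ rfl).trans ?_
          gcongr
          · exact pointwise hp hh hfm x
          · exact pointwise hp hh hgm x
      _ = c * (c * (∫⁻ x in Metric.closedBall (0 : Rn n) A, J p h f x ∂μ
            + ∫⁻ x in Metric.closedBall (0 : Rn n) A, J p h g x ∂μ) + z * V) := by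
          have hf' := measurable_J (p := p) (h := h) hfm
          have hg' := measurable_J (p := p) (h := h) hgm
          rw [lintegral_const_mul' _ _ hcT,
            lintegral_add_right _ measurable_const,
            lintegral_const_mul' _ _ hcT, lintegral_add_left hf', setLIntegral_const]
      _ ≤ c * (c * (R * e2 + R * e2) + z * V) := by
          gcongr
          · exact (setLIntegral_le_lintegral _ _).trans (hJ f hf)
          · exact (setLIntegral_le_lintegral _ _).trans (hJ g hgH)
      _ = c * c * 2 * R * e2 + c * V * z := by ring
      _ ≤ e / 4 + e / 4 := add_le_add he2K hzK
  calc _ ≤ e / 4 + (e / 4 + e / 4) := add_le_add hout hin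
    _ ≤ e / 4 + (e / 4 + e / 4) + e / 4 := le_self_add
    _ = 4 * (e / 4) := by ring
    _ ≤ e := ENNReal.mul_div_le

end FK

/-- Lemma 4.3, Clop–Cruz: a Fréchet–Kolmogorov–Riesz
compactness criterion in weighted `L^p(w)`.  Precompactness is expressed as
total boundedness with respect to the weighted `L^p(w)` distance. -/
theorem stmt11 {n : ℕ} (hn : 0 < n)
    (p : ℝ) (hp : 1 < p) (w : Rn n → ℝ) (hw : IsAp p w)
    (H : Set (Rn n → ℝ)) (hmeas : ∀ f ∈ H, Measurable f)
    (hbdd : ∃ C : ℝ, ∀ f ∈ H, wLp p w f ≤ ENNReal.ofReal C)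
    (hdecay : ∀ ε : ℝ, 0 < ε → ∃ A : ℝ, ∀ f ∈ H,
      (∫⁻ x in {x : Rn n | A < ‖x‖},
          ENNReal.ofReal |f x| ^ p * ENNReal.ofReal (w x)) ≤ ENNReal.ofReal ε)
    (htrans : ∀ ε : ℝ, 0 < ε → ∃ t0 : ℝ, 0 < t0 ∧ ∀ t : Rn n, ‖t‖ < t0 →
      ∀ f ∈ H, wLp p w (fun x => f (x + t) - f x) ≤ ENNReal.ofReal ε) :
    ∀ ε : ℝ, 0 < ε → ∃ G : Set (Rn n → ℝ), G.Finite ∧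
      ∀ f ∈ H, ∃ g ∈ G, wLp p w (fun x => f x - g x) ≤ ENNReal.ofReal ε := by
  have hp0 : 0 < p := by linarith
  obtain ⟨hw0, hwl, -⟩ := hw
  have hwm : AEMeasurable (fun x => ENNReal.ofReal (w x)) volume :=
    hwl.aestronglyMeasurable.aemeasurable.ennreal_ofReal
  set μ : Measure (Rn n) := volume.withDensity (fun x => ENNReal.ofReal (w x)) with hμ
  have hI : ∀ f : Rn n → ℝ, Measurable f →
      ∫⁻ x, ENNReal.ofReal |f x| ^ p * ENNReal.ofReal (w x) = ∫⁻ x, ‖f x‖ₑ ^ p ∂μ := by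
    intro f hf
    rw [hμ, lintegral_withDensity_eq_lintegral_mul₀ hwm (hf.enorm.pow_const p).aemeasurable]
    refine lintegral_congr fun x => ?_
    rw [Pi.mul_apply, Real.enorm_eq_ofReal_abs, mul_comm]
  have hwLp : ∀ (f : Rn n → ℝ) (a : ℝ≥0∞), Measurable f →
      (wLp p w f ≤ a ↔ ∫⁻ x, ‖f x‖ₑ ^ p ∂μ ≤ a ^ p) := by
    intro f a hf
    rw [wLp, hI f hf, one_div, ENNReal.rpow_inv_le_iff hp0]
  have hfin : ∀ r : ℝ, μ (Metric.closedBall 0 r) < ∞ := by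
    intro r
    rw [hμ, withDensity_apply _ Metric.isClosed_closedBall.measurableSet]
    have h1 := (hwl.integrableOn_isCompact (isCompact_closedBall (0 : Rn n) r)).lintegral_lt_top
    exact h1
  intro ε hε
  obtain ⟨C, hC⟩ := hbdd
  have hε0 : ENNReal.ofReal ε ≠ 0 := by simpa using hε
  obtain ⟨G, hGf, hGH, hG⟩ := FK.main hp.le μ hfin H hmeas
    ⟨ENNReal.ofReal C ^ p, ENNReal.rpow_ne_top_of_nonneg hp0.le ENNReal.ofReal_ne_top,
      fun f hf => (hwLp f _ (hmeas f hf)).1 (hC f hf)⟩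
    (by
      intro e he heT
      obtain ⟨A, hA⟩ := hdecay e.toReal (ENNReal.toReal_pos he heT)
      refine ⟨A, fun f hf => ?_⟩
      have h1 := hA f hf
      rw [ENNReal.ofReal_toReal heT] at h1
      refine le_trans (le_of_eq ?_) h1
      have hUm : MeasurableSet {x : Rn n | A < ‖x‖} :=
        measurableSet_lt measurable_const measurable_norm
      rw [hμ, setLIntegral_withDensity_eq_lintegral_mul₀ hwm
        ((hmeas f hf).enorm.pow_const p).aemeasurable hUm]
      refine lintegral_congr fun x => ?_
      rw [Pi.mul_apply, Real.enorm_eq_ofReal_abs, mul_comm])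
    (by
      intro e he heT
      have hT : e ^ (1 / p) ≠ ∞ := ENNReal.rpow_ne_top_of_nonneg (by positivity) heT
      obtain ⟨t0, ht0, h1⟩ := htrans (e ^ (1 / p)).toReal
        (ENNReal.toReal_pos (by simp [ENNReal.rpow_eq_zero_iff, he, heT]) hT)
      refine ⟨t0, ht0, fun t ht f hf => ?_⟩
      have hm := hmeas f hf
      have h2 := (hwLp _ _ ((hm.comp (measurable_id.add_const t)).sub hm)).1 (h1 t ht f hf)
      rw [ENNReal.ofReal_toReal hT, ← ENNReal.rpow_mul, one_div,
        inv_mul_cancel₀ hp0.ne', ENNReal.rpow_one] at h2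
      exact h2)
    (ENNReal.ofReal ε ^ p)
    (by simp [ENNReal.rpow_eq_zero_iff, hε, hp0.le])
    (ENNReal.rpow_ne_top_of_nonneg hp0.le ENNReal.ofReal_ne_top)
  refine ⟨G, hGf, fun f hf => ?_⟩
  obtain ⟨g, hg, h1⟩ := hG f hf
  exact ⟨g, hg, (hwLp _ _ ((hmeas f hf).sub (hmeas g (hGH hg)))).2 h1⟩
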